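/- Let μ be a probability measure on a measurable space Ω, let T be a measurable treatment event, let L₁, …, Lₘ be a finite measurable partition of Ω (the strata) with μ(T ∩ Lₗ) > 0 and μ(Tᶜ ∩ Lₗ) > 0 for all l, and let Y₀, Y₁ : Ω → ℝ be integrable random variables with actual outcome Y(ω) = Y₁(ω) if ω ∈ T and Y(ω) = Y₀(ω) otherwise. If within each stratum the potential outcome Y₀ is mean-exchangeable across treatment groups (E[Y₀ | T ∩ Lₗ] = E[Y₀ | Tᶜ ∩ Lₗ] for all l, where E[· | A] is the expectation under the conditional measure μ(· | A)), then the ATT admits the stratified non-parametric representation: E[Y₁ − Y₀ | T] = ∑ₗ μ(Lₗ | T) · ( E[Y | T ∩ Lₗ] − E[Y | Tᶜ ∩ Lₗ] ). -/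

import Mathlib

open MeasureTheory ProbabilityTheory
open scoped Classical

/-- The conditional probability `μ(B | A) = μ(B ∩ A) / μ(A)`, as a real number. -/
noncomputable def condProb {Ω : Type*} [MeasurableSpace Ω] (μ : Measure Ω) (B A : Set Ω) : ℝ :=
  (μ (B ∩ A)).toReal / (μ A).toReal

/-- **Stratified non-parametric representation of the ATT.**
Let `L₁, …, Lₘ` be a finite measurable partition (the strata) with `μ(T ∩ Lₗ) > 0` and
`μ(Tᶜ ∩ Lₗ) > 0` for all `l`, and let the actual outcome `Y` be `Y₁` on the treated set `T`
and `Y₀` off `T`.  If within each stratum `Y₀` is mean-exchangeable across treatment groups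
(`E[Y₀ | T ∩ Lₗ] = E[Y₀ | Tᶜ ∩ Lₗ]`), then
`E[Y₁ − Y₀ | T] = ∑ₗ μ(Lₗ | T) · (E[Y | T ∩ Lₗ] − E[Y | Tᶜ ∩ Lₗ])`. -/
theorem att_stratified_nonparametric {Ω : Type*} [MeasurableSpace Ω]
    (μ : Measure Ω) [IsProbabilityMeasure μ]
    (T : Set Ω) (hT : MeasurableSet T)
    {m : ℕ} (L : Fin m → Set Ω) (hLmeas : ∀ l, MeasurableSet (L l))
    (hLdisj : Pairwise (Function.onFun Disjoint L)) (hLcover : (⋃ l, L l) = Set.univ)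
    (hposT : ∀ l, 0 < μ (T ∩ L l)) (hposTc : ∀ l, 0 < μ (Tᶜ ∩ L l))
    (Y₀ Y₁ : Ω → ℝ) (hY₀ : Integrable Y₀ μ) (hY₁ : Integrable Y₁ μ)
    (Y : Ω → ℝ) (hY : ∀ ω, Y ω = if ω ∈ T then Y₁ ω else Y₀ ω)
    (hexch : ∀ l, ∫ ω, Y₀ ω ∂(μ[|T ∩ L l]) = ∫ ω, Y₀ ω ∂(μ[|Tᶜ ∩ L l])) :
    ∫ ω, (Y₁ ω - Y₀ ω) ∂(μ[|T]) =
      ∑ l, condProb μ (L l) T *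
        ((∫ ω, Y ω ∂(μ[|T ∩ L l])) - ∫ ω, Y ω ∂(μ[|Tᶜ ∩ L l])) := by
  have key : ∀ (A : Set Ω) (f : Ω → ℝ),
      ∫ ω, f ω ∂(μ[|A]) = (μ A).toReal⁻¹ * ∫ ω in A, f ω ∂μ := by
    intro A f
    rw [ProbabilityTheory.cond, integral_smul_measure, ENNReal.toReal_inv, smul_eq_mul]
  have hterm : ∀ l, condProb μ (L l) T *
        ((∫ ω, Y ω ∂(μ[|T ∩ L l])) - ∫ ω, Y ω ∂(μ[|Tᶜ ∩ L l])) =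
      (μ T).toReal⁻¹ * ∫ ω in T ∩ L l, (Y₁ ω - Y₀ ω) ∂μ := by
    intro l
    have h1 : ∫ ω, Y ω ∂(μ[|T ∩ L l]) = ∫ ω, Y₁ ω ∂(μ[|T ∩ L l]) := by
      rw [key, key]
      congr 1
      refine setIntegral_congr_fun (hT.inter (hLmeas l)) fun ω hω => ?_
      simp [hY, hω.1]
    have h0 : ∫ ω, Y ω ∂(μ[|Tᶜ ∩ L l]) = ∫ ω, Y₀ ω ∂(μ[|Tᶜ ∩ L l]) := by
      rw [key, key]
      congr 1
      refine setIntegral_congr_fun (hT.compl.inter (hLmeas l)) fun ω hω => ?_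
      have : ω ∉ T := hω.1
      simp [hY, this]
    have hne : (μ (T ∩ L l)).toReal ≠ 0 :=
      (ENNReal.toReal_pos (hposT l).ne' (measure_ne_top _ _)).ne'
    rw [h1, h0, ← hexch l, key, key, integral_sub hY₁.integrableOn hY₀.integrableOn,
      condProb, Set.inter_comm (L l) T, ← mul_sub, div_eq_inv_mul, mul_assoc,
      mul_inv_cancel_left₀ hne]
  have hU : T = ⋃ l, T ∩ L l := by rw [← Set.inter_iUnion, hLcover, Set.inter_univ]
  have hsum : ∫ ω in T, (Y₁ ω - Y₀ ω) ∂μ = ∑ l, ∫ ω in T ∩ L l, (Y₁ ω - Y₀ ω) ∂μ := by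
    conv_lhs => rw [hU]
    refine integral_iUnion_fintype (fun l => hT.inter (hLmeas l)) ?_ ?_
    · intro i j hij
      exact (hLdisj hij).mono Set.inter_subset_right Set.inter_subset_right
    · intro l
      exact (hY₁.sub hY₀).integrableOn
  rw [key, hsum, Finset.mul_sum]
  exact Finset.sum_congr rfl fun l _ => (hterm l).symm
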